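/- Let a, b, c > 0 satisfy the strict triangle inequalities a < b + c, b < c + a and c < a + b. Then the series Σ_{m=0}^{∞} D_m converges and Σ_{m=0}^{∞} D_m = −(bc/a)·K⁻¹_{abc}(0,0;1,0) = −(bc/a)·(2πi)^{−2} ∮_{|z|=1} ( ∮_{|w|=1} (a+bz+cw)^{−1} dw ) dz. (This identifies the speed of growth of the interface, defined through the prescribed dynamics under the stationary measure, with the off-diagonal entry of the inverse Kasteleyn matrix.) -/

import Mathlib

open MeasureTheory

/-- The infinite-volume inverse Kasteleyn kernel `K⁻¹_{abc}(x,n;x',n')` for the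
honeycomb graph with weights `a, b, c`. -/
noncomputable def Kinv (a b c : ℝ) (x n x' n' : ℤ) : ℂ :=
  ((2 * (Real.pi : ℂ) * Complex.I) ^ 2)⁻¹ *
    (∮ z in C(0, 1), ∮ w in C(0, 1),
      z ^ (n - n') * w ^ (n' - n + x' - x - 1) * ((a : ℂ) + (b : ℂ) * z + (c : ℂ) * w)⁻¹)

/-- `D_m`: the probability, under the translation-invariant ergodic Gibbs measure on
dimer coverings of the honeycomb with weights `a, b, c`, that the type-I dimers at
`(0,0),(0,−1),…,(0,−m)` are all present while the type-I dimer at `(1,−m−1)` is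
absent, written as a difference of determinants. -/
noncomputable def D (a b c : ℝ) (m : ℕ) : ℂ :=
  (Matrix.of (fun i j : Fin (m + 1) =>
      (b : ℂ) * Kinv a b c 0 (-((i : ℕ) : ℤ)) 0 (-((j : ℕ) : ℤ)))).det -
  (Matrix.of (fun i j : Fin (m + 2) =>
      (b : ℂ) *
        Kinv a b c
          (if (i : ℕ) ≤ m then 0 else 1)
          (if (i : ℕ) ≤ m then -((i : ℕ) : ℤ) else -(m : ℤ) - 1)
          (if (j : ℕ) ≤ m then 0 else 1)
          (if (j : ℕ) ≤ m then -((j : ℕ) : ℤ) else -(m : ℤ) - 1))).det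

theorem circleIntegral_zpow (k : ℤ) :
    (∮ w in C(0, 1), w ^ k) = if k = -1 then 2 * (Real.pi : ℂ) * Complex.I else 0 := by
  split_ifs with h
  · subst h
    simpa using circleIntegral.integral_sub_center_inv 0 (one_ne_zero (α := ℝ))
  · simpa using circleIntegral.integral_sub_zpow_of_ne h 0 0 1

theorem norm_eq_one_of_mem_sphere {w : ℂ} (hw : w ∈ Metric.sphere (0 : ℂ) 1) : ‖w‖ = 1 := by
  simpa using hw

theorem ne_zero_of_mem_unitCircle {w : ℂ} (hw : w ∈ Metric.sphere (0 : ℂ) 1) : w ≠ 0 :=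
  norm_ne_zero_iff.1 (by rw [norm_eq_one_of_mem_sphere hw]; exact one_ne_zero)

theorem circleIntegrable_zpow_mul_sub_inv {v : ℂ} (hv : ‖v‖ ≠ 1) (k : ℤ) :
    CircleIntegrable (fun w => w ^ k * (w - v)⁻¹) 0 1 := by
  refine ContinuousOn.circleIntegrable zero_le_one ?_
  refine ContinuousOn.mul (continuousOn_id.zpow₀ k fun w hw => Or.inl (ne_zero_of_mem_unitCircle hw))
    (ContinuousOn.inv₀ (by fun_prop) fun w hw h => hv ?_)
  rw [← sub_eq_zero.1 h, norm_eq_one_of_mem_sphere hw]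

theorem circleIntegral_zpow_mul_sub_inv_succ {v : ℂ} (hv : ‖v‖ ≠ 1) (k : ℤ) :
    (∮ w in C(0, 1), w ^ (k + 1) * (w - v)⁻¹) =
      v * (∮ w in C(0, 1), w ^ k * (w - v)⁻¹) +
        if k = -1 then 2 * (Real.pi : ℂ) * Complex.I else 0 := by
  rw [← circleIntegral_zpow, ← circleIntegral.integral_const_mul,
    ← circleIntegral.integral_add]
  · refine circleIntegral.integral_congr zero_le_one fun w hw => ?_
    have h0 := ne_zero_of_mem_unitCircle hw
    have h1 : w - v ≠ 0 := fun h => hv (by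
      rw [← sub_eq_zero.1 h, norm_eq_one_of_mem_sphere hw])
    simp only [zpow_add₀ h0, zpow_one]
    field_simp
    ring
  · exact (circleIntegrable_zpow_mul_sub_inv hv k).const_smul
  · exact ContinuousOn.circleIntegrable zero_le_one
      (continuousOn_id.zpow₀ k fun w hw => Or.inl (ne_zero_of_mem_unitCircle hw))

theorem circleIntegral_zpow_mul_sub_inv_of_norm_lt {v : ℂ} (hv : ‖v‖ < 1) (k : ℤ) :
    (∮ w in C(0, 1), w ^ k * (w - v)⁻¹) =
      if 0 ≤ k then 2 * (Real.pi : ℂ) * Complex.I * v ^ k else 0 := by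
  have h0 : (∮ w in C(0, 1), w ^ (0 : ℤ) * (w - v)⁻¹) = 2 * (Real.pi : ℂ) * Complex.I := by
    simpa using circleIntegral.integral_sub_inv_of_mem_ball (c := 0) (R := 1) (by simpa using hv)
  rcases eq_or_ne v 0 with rfl | hv0
  · have : (∮ w in C(0, 1), w ^ k * (w - 0)⁻¹) = ∮ w in C(0, 1), w ^ (k - 1) := by
      refine circleIntegral.integral_congr zero_le_one fun w hw => ?_
      simp only [sub_zero, zpow_sub_one₀ (ne_zero_of_mem_unitCircle hw)]
    rw [this, circleIntegral_zpow]
    rcases lt_trichotomy k 0 with h | h | h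
    · rw [if_neg (by omega), if_neg (by omega)]
    · simp [h]
    · rw [if_neg (by omega), if_pos h.le, zero_zpow _ h.ne', mul_zero]
  · induction k using Int.induction_on with
    | zero => simpa using h0
    | succ i ih =>
      rw [circleIntegral_zpow_mul_sub_inv_succ hv.ne, ih, if_neg (by omega : ¬(i : ℤ) = -1),
        if_pos (by omega), if_pos (by omega), zpow_add_one₀ hv0]
      ring
    | pred i ih =>
      have h := circleIntegral_zpow_mul_sub_inv_succ hv.ne (-(i : ℤ) - 1)
      rw [sub_add_cancel, ih] at h
      rw [if_neg (by omega)]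
      rcases Nat.eq_zero_or_pos i with rfl | hi
      · simpa [hv0] using h
      · rw [if_neg (by omega), if_neg (by omega), add_zero] at h
        exact (mul_eq_zero.1 h.symm).resolve_left hv0

theorem circleIntegral_zpow_mul_sub_inv_of_lt_norm {v : ℂ} (hv : 1 < ‖v‖) (k : ℤ) :
    (∮ w in C(0, 1), w ^ k * (w - v)⁻¹) =
      if 0 ≤ k then 0 else -(2 * (Real.pi : ℂ) * Complex.I * v ^ k) := by
  have h1 : ∀ w ∈ Metric.closedBall (0 : ℂ) 1, w - v ≠ 0 := by
    intro w hw h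
    rw [sub_eq_zero.1 h] at hw
    simp only [mem_closedBall_zero_iff] at hw
    linarith
  have h0 : (∮ w in C(0, 1), w ^ (0 : ℤ) * (w - v)⁻¹) = 0 := by
    refine Complex.circleIntegral_eq_zero_of_differentiable_on_off_countable zero_le_one
      Set.countable_empty ?_ ?_
    · simp only [zpow_zero, one_mul]
      exact ContinuousOn.inv₀ (by fun_prop) h1
    · intro w hw
      simp only [zpow_zero, one_mul]
      exact DifferentiableAt.inv (by fun_prop) (h1 w (Metric.ball_subset_closedBall hw.1))
  have hv0 : v ≠ 0 := norm_ne_zero_iff.1 (by linarith)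
  induction k using Int.induction_on with
  | zero => simpa using h0
  | succ i ih =>
    rw [circleIntegral_zpow_mul_sub_inv_succ hv.ne', ih, if_neg (by omega : ¬(i : ℤ) = -1),
      if_pos (by omega), if_pos (by omega)]
    ring
  | pred i ih =>
    have h := circleIntegral_zpow_mul_sub_inv_succ hv.ne' (-(i : ℤ) - 1)
    rw [sub_add_cancel, ih] at h
    rw [if_neg (by omega)]
    apply mul_left_cancel₀ hv0
    rw [zpow_sub_one₀ hv0]
    rcases Nat.eq_zero_or_pos i with rfl | hi
    · simp only [Nat.cast_zero, neg_zero, le_refl, if_true, zero_sub] at h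
      simp only [Nat.cast_zero, neg_zero, zero_sub, zpow_zero]
      linear_combination -h + 2 * (Real.pi : ℂ) * Complex.I * mul_inv_cancel₀ hv0
    · rw [if_neg (by omega), if_neg (by omega), add_zero] at h
      rw [← h]
      field_simp

/-- Point of the unit circle with argument `θ`. -/
noncomputable def unitPoint (θ : ℝ) : ℂ := Complex.exp (θ * Complex.I)

theorem unitPoint_ne_zero (θ : ℝ) : unitPoint θ ≠ 0 := Complex.exp_ne_zero _

theorem unitPoint_re (θ : ℝ) : (unitPoint θ).re = Real.cos θ := Complex.exp_ofReal_mul_I_re θ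

theorem unitPoint_im (θ : ℝ) : (unitPoint θ).im = Real.sin θ := Complex.exp_ofReal_mul_I_im θ

theorem norm_unitPoint (θ : ℝ) : ‖unitPoint θ‖ = 1 := Complex.norm_exp_ofReal_mul_I θ

theorem unitPoint_add (θ φ : ℝ) : unitPoint (θ + φ) = unitPoint θ * unitPoint φ := by
  simp only [unitPoint]
  rw [← Complex.exp_add]
  push_cast
  ring_nf

theorem unitPoint_neg (θ : ℝ) : unitPoint (-θ) = (unitPoint θ)⁻¹ := by
  simp only [unitPoint]
  rw [← Complex.exp_neg]
  push_cast
  ring_nf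

theorem unitPoint_two_pi : unitPoint (2 * Real.pi) = 1 := by
  simp only [unitPoint]
  push_cast
  exact Complex.exp_two_pi_mul_I

theorem hasDerivAt_unitPoint (θ : ℝ) : HasDerivAt unitPoint (unitPoint θ * Complex.I) θ := by
  have h : HasDerivAt (fun t : ℝ => (t : ℂ) * Complex.I) Complex.I θ := by
    simpa using (Complex.ofRealCLM.hasDerivAt (x := θ)).mul_const Complex.I
  exact h.cexp

theorem continuous_unitPoint : Continuous unitPoint := by
  unfold unitPoint
  fun_prop

theorem circleMap_eq_unitPoint (θ : ℝ) : circleMap 0 1 θ = unitPoint θ := by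
  simp [circleMap, unitPoint]

theorem circleIntegral_eq_add_arcs {A : ℝ} (hA0 : 0 < A) (hA : A < Real.pi) {G : ℂ → ℂ}
    {g h : ℝ → ℂ} (hg : ContinuousOn g (Set.Icc (-A) A))
    (hh : ContinuousOn h (Set.Icc A (2 * Real.pi - A)))
    (hGg : ∀ θ ∈ Set.Ioo (-A) A, G (unitPoint θ) = g θ)
    (hGh : ∀ θ ∈ Set.Ioo A (2 * Real.pi - A), G (unitPoint θ) = h θ) :
    (∮ z in C(0, 1), G z) =
      (∫ θ in (-A)..A, unitPoint θ * Complex.I * g θ) +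
        ∫ θ in A..(2 * Real.pi - A), unitPoint θ * Complex.I * h θ := by
  have h1 : (-A) ≤ A := by linarith
  have h2 : A ≤ 2 * Real.pi - A := by linarith
  have hcirc : (∮ z in C(0, 1), G z) =
      ∫ θ in (0 : ℝ)..(0 + 2 * Real.pi), unitPoint θ * Complex.I * G (unitPoint θ) := by
    simp only [circleIntegral, deriv_circleMap, circleMap_eq_unitPoint, smul_eq_mul, zero_add]
  have hper : Function.Periodic (fun θ => unitPoint θ * Complex.I * G (unitPoint θ))
      (2 * Real.pi) := by
    intro θ
    simp only [unitPoint_add, unitPoint_two_pi, mul_one]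
  have e1 : Set.EqOn (fun θ => unitPoint θ * Complex.I * g θ)
      (fun θ => unitPoint θ * Complex.I * G (unitPoint θ)) (Set.Ioo (-A) A) :=
    fun θ hθ => by simp only [hGg θ hθ]
  have e2 : Set.EqOn (fun θ => unitPoint θ * Complex.I * h θ)
      (fun θ => unitPoint θ * Complex.I * G (unitPoint θ)) (Set.Ioo A (2 * Real.pi - A)) :=
    fun θ hθ => by simp only [hGh θ hθ]
  have c1 : ContinuousOn (fun θ => unitPoint θ * Complex.I * g θ) (Set.uIcc (-A) A) := by
    rw [Set.uIcc_of_le h1]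
    exact ((continuous_unitPoint.mul continuous_const).continuousOn).mul hg
  have c2 : ContinuousOn (fun θ => unitPoint θ * Complex.I * h θ)
      (Set.uIcc A (2 * Real.pi - A)) := by
    rw [Set.uIcc_of_le h2]
    exact ((continuous_unitPoint.mul continuous_const).continuousOn).mul hh
  rw [hcirc, hper.intervalIntegral_add_eq 0 (-A), show -A + 2 * Real.pi = 2 * Real.pi - A by ring,
    ← intervalIntegral.integral_add_adjacent_intervals (b := A),
    intervalIntegral.integral_congr_Ioo_of_le h1 e1.symm,
    intervalIntegral.integral_congr_Ioo_of_le h2 e2.symm]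
  · refine c1.intervalIntegrable.congr_uIoo ?_
    rwa [Set.uIoo_of_le h1]
  · refine c2.intervalIntegrable.congr_uIoo ?_
    rwa [Set.uIoo_of_le h2]

/-- The inverse Kasteleyn kernel in terms of the exponents of `z` and `w`. -/
noncomputable def kernelCoeff (a b c : ℝ) (p q : ℤ) : ℂ :=
  ((2 * (Real.pi : ℂ) * Complex.I) ^ 2)⁻¹ *
    (∮ z in C(0, 1), ∮ w in C(0, 1), z ^ p * w ^ q * ((a : ℂ) + (b : ℂ) * z + (c : ℂ) * w)⁻¹)

theorem Kinv_eq_kernelCoeff (a b c : ℝ) (x n x' n' : ℤ) :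
    Kinv a b c x n x' n' = kernelCoeff a b c (n - n') (n' - n + x' - x - 1) := rfl

/-- The root `w` of `a + b * z + c * w` at the point `z` of the unit circle with argument `θ`. -/
noncomputable def kernelRoot (a b c : ℝ) (θ : ℝ) : ℂ := -(((a : ℂ) + b * unitPoint θ) / c)

theorem normSq_add_mul_unitPoint (a b θ : ℝ) :
    ‖(a : ℂ) + b * unitPoint θ‖ ^ 2 = a ^ 2 + b ^ 2 + 2 * a * b * Real.cos θ := by
  rw [← Complex.normSq_eq_norm_sq, Complex.normSq_apply]
  simp only [Complex.add_re, Complex.add_im, Complex.mul_re, Complex.mul_im, Complex.ofReal_re,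
    Complex.ofReal_im, unitPoint_re, unitPoint_im]
  linear_combination b ^ 2 * Real.sin_sq_add_cos_sq θ

theorem norm_kernelRoot_sq {c : ℝ} (hc : 0 < c) (a b θ : ℝ) :
    ‖kernelRoot a b c θ‖ ^ 2 = (a ^ 2 + b ^ 2 + 2 * a * b * Real.cos θ) / c ^ 2 := by
  rw [kernelRoot, norm_neg, norm_div, div_pow, normSq_add_mul_unitPoint, Complex.norm_real,
    Real.norm_of_nonneg hc.le]

theorem cos_lt_cos_of_abs_lt {A θ : ℝ} (hA : A < Real.pi) (h : |θ| < A) :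
    Real.cos A < Real.cos θ := by
  rw [← Real.cos_abs θ]
  exact Real.cos_lt_cos_of_nonneg_of_le_pi (abs_nonneg _) hA.le h

theorem cos_lt_cos_of_mem_compl {A θ : ℝ} (hA : 0 < A)
    (h : θ ∈ Set.Ioo A (2 * Real.pi - A)) : Real.cos θ < Real.cos A := by
  obtain ⟨h1, h2⟩ := h
  rcases le_total θ Real.pi with h3 | h3
  · exact Real.cos_lt_cos_of_nonneg_of_le_pi hA.le h3 h1
  · rw [← Real.cos_two_pi_sub θ]
    exact Real.cos_lt_cos_of_nonneg_of_le_pi hA.le (by linarith) (by linarith)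

section Arcs

variable {a b c A : ℝ}

theorem one_lt_norm_kernelRoot (ha : 0 < a) (hb : 0 < b) (hc : 0 < c) (hAπ : A < Real.pi)
    (hA : a ^ 2 + b ^ 2 + 2 * a * b * Real.cos A = c ^ 2) {θ : ℝ}
    (hθ : θ ∈ Set.Ioo (-A) A) : 1 < ‖kernelRoot a b c θ‖ := by
  have h := cos_lt_cos_of_abs_lt hAπ (abs_lt.2 hθ)
  refine lt_of_pow_lt_pow_left₀ 2 (norm_nonneg _) ?_
  rw [norm_kernelRoot_sq hc, one_pow, one_lt_div (by positivity), ← hA]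
  have := mul_lt_mul_of_pos_left h (by positivity : 0 < 2 * a * b)
  linarith

theorem norm_kernelRoot_lt_one (ha : 0 < a) (hb : 0 < b) (hc : 0 < c) (hA0 : 0 < A)
    (hA : a ^ 2 + b ^ 2 + 2 * a * b * Real.cos A = c ^ 2) {θ : ℝ}
    (hθ : θ ∈ Set.Ioo A (2 * Real.pi - A)) : ‖kernelRoot a b c θ‖ < 1 := by
  have h := cos_lt_cos_of_mem_compl hA0 hθ
  refine lt_of_pow_lt_pow_left₀ 2 zero_le_one ?_
  rw [norm_kernelRoot_sq hc, one_pow, div_lt_one (by positivity), ← hA]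
  have := mul_lt_mul_of_pos_left h (by positivity : 0 < 2 * a * b)
  linarith

theorem add_mul_unitPoint_mem_slitPlane (ha : 0 < a) (hb : 0 < b) (hA : A < Real.pi) {θ : ℝ}
    (hθ : θ ∈ Set.Icc (-A) A) : (a : ℂ) + b * unitPoint θ ∈ Complex.slitPlane := by
  rw [Complex.mem_slitPlane_iff]
  simp only [Complex.add_re, Complex.add_im, Complex.mul_re, Complex.mul_im, Complex.ofReal_re,
    Complex.ofReal_im, unitPoint_re, unitPoint_im]
  rcases eq_or_ne θ 0 with rfl | h
  · left
    simp only [Real.cos_zero]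
    linarith
  · right
    have : Real.sin θ ≠ 0 := by
      rw [Ne, Real.sin_eq_zero_iff_of_lt_of_lt (by linarith [hθ.1]) (by linarith [hθ.2])]
      exact h
    simpa using ⟨hb.ne', this⟩

theorem kernelRoot_ne_zero (ha : 0 < a) (hb : 0 < b) (hc : 0 < c) (hA : A < Real.pi) {θ : ℝ}
    (hθ : θ ∈ Set.Icc (-A) A) : kernelRoot a b c θ ≠ 0 :=
  neg_ne_zero.2 (div_ne_zero
    (Complex.slitPlane_ne_zero (add_mul_unitPoint_mem_slitPlane ha hb hA hθ))
    (Complex.ofReal_ne_zero.2 hc.ne'))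

theorem continuous_kernelRoot (a b c : ℝ) : Continuous (kernelRoot a b c) := by
  have := continuous_unitPoint
  unfold kernelRoot
  fun_prop

theorem inner_circleIntegral_eq (hc : 0 < c) (θ : ℝ) (p q : ℤ) :
    (∮ w in C(0, 1), unitPoint θ ^ p * w ^ q *
        ((a : ℂ) + (b : ℂ) * unitPoint θ + (c : ℂ) * w)⁻¹) =
      unitPoint θ ^ p * (c : ℂ)⁻¹ * ∮ w in C(0, 1), w ^ q * (w - kernelRoot a b c θ)⁻¹ := by
  have hc' : (c : ℂ) ≠ 0 := Complex.ofReal_ne_zero.2 hc.ne'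
  rw [← circleIntegral.integral_const_mul]
  congr 1
  ext w
  have : (a : ℂ) + (b : ℂ) * unitPoint θ + (c : ℂ) * w = c * (w - kernelRoot a b c θ) := by
    rw [kernelRoot]
    field_simp
    ring
  rw [this, mul_inv]
  ring

theorem kernelCoeff_of_nonneg (ha : 0 < a) (hb : 0 < b) (hc : 0 < c) (hA0 : 0 < A)
    (hAπ : A < Real.pi) (hA : a ^ 2 + b ^ 2 + 2 * a * b * Real.cos A = c ^ 2) (p : ℤ) {q : ℤ}
    (hq : 0 ≤ q) :
    kernelCoeff a b c p q = (2 * (Real.pi : ℂ) * Complex.I)⁻¹ *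
      ∫ θ in A..(2 * Real.pi - A), unitPoint θ * Complex.I *
        (unitPoint θ ^ p * (c : ℂ)⁻¹ * kernelRoot a b c θ ^ q) := by
  have hπ : (2 * (Real.pi : ℂ) * Complex.I) ≠ 0 := Complex.two_pi_I_ne_zero
  rw [kernelCoeff, circleIntegral_eq_add_arcs hA0 hAπ (g := 0)
    (h := fun θ => (2 * (Real.pi : ℂ) * Complex.I) *
      (unitPoint θ ^ p * (c : ℂ)⁻¹ * kernelRoot a b c θ ^ q))]
  · simp only [Pi.zero_apply, mul_zero, intervalIntegral.integral_zero, zero_add,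
      mul_left_comm _ (2 * (Real.pi : ℂ) * Complex.I), intervalIntegral.integral_const_mul]
    field_simp
  · exact continuousOn_const
  · refine Continuous.continuousOn ?_
    refine continuous_const.mul ((Continuous.mul ?_ continuous_const).mul ?_)
    · exact continuous_unitPoint.zpow₀ p fun θ => Or.inl (unitPoint_ne_zero θ)
    · exact (continuous_kernelRoot a b c).zpow₀ q fun θ => Or.inr hq
  · intro θ hθ
    rw [inner_circleIntegral_eq hc, circleIntegral_zpow_mul_sub_inv_of_lt_norm
      (one_lt_norm_kernelRoot ha hb hc hAπ hA hθ), if_pos hq, mul_zero, Pi.zero_apply]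
  · intro θ hθ
    rw [inner_circleIntegral_eq hc, circleIntegral_zpow_mul_sub_inv_of_norm_lt
      (norm_kernelRoot_lt_one ha hb hc hA0 hA hθ), if_pos hq]
    ring

theorem kernelCoeff_of_neg (ha : 0 < a) (hb : 0 < b) (hc : 0 < c) (hA0 : 0 < A)
    (hAπ : A < Real.pi) (hA : a ^ 2 + b ^ 2 + 2 * a * b * Real.cos A = c ^ 2) (p : ℤ) {q : ℤ}
    (hq : q < 0) :
    kernelCoeff a b c p q = -((2 * (Real.pi : ℂ) * Complex.I)⁻¹ *
      ∫ θ in (-A)..A, unitPoint θ * Complex.I *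
        (unitPoint θ ^ p * (c : ℂ)⁻¹ * kernelRoot a b c θ ^ q)) := by
  have hπ : (2 * (Real.pi : ℂ) * Complex.I) ≠ 0 := Complex.two_pi_I_ne_zero
  rw [kernelCoeff, circleIntegral_eq_add_arcs hA0 hAπ (h := 0)
    (g := fun θ => (-(2 * (Real.pi : ℂ) * Complex.I)) *
      (unitPoint θ ^ p * (c : ℂ)⁻¹ * kernelRoot a b c θ ^ q))]
  · simp only [Pi.zero_apply, mul_zero, intervalIntegral.integral_zero, add_zero,
      mul_left_comm _ (-(2 * (Real.pi : ℂ) * Complex.I)), intervalIntegral.integral_const_mul]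
    field_simp
  · refine continuousOn_const.mul ((ContinuousOn.mul ?_ continuousOn_const).mul ?_)
    · exact (continuous_unitPoint.zpow₀ p fun θ => Or.inl (unitPoint_ne_zero θ)).continuousOn
    · exact (continuous_kernelRoot a b c).continuousOn.zpow₀ q fun θ hθ =>
        Or.inl (kernelRoot_ne_zero ha hb hc hAπ hθ)
  · exact continuousOn_const
  · intro θ hθ
    rw [inner_circleIntegral_eq hc, circleIntegral_zpow_mul_sub_inv_of_lt_norm
      (one_lt_norm_kernelRoot ha hb hc hAπ hA hθ), if_neg hq.not_ge]
    ring
  · intro θ hθ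
    rw [inner_circleIntegral_eq hc, circleIntegral_zpow_mul_sub_inv_of_norm_lt
      (norm_kernelRoot_lt_one ha hb hc hA0 hA hθ), if_neg hq.not_ge, mul_zero, Pi.zero_apply]

end Arcs

/-- Moments of the powers of `b / (c + b * u)` over the arc `|arg u| ≤ B` of the unit circle. -/
noncomputable def arcMoment (b c B : ℝ) (e : ℕ) (k : ℤ) : ℂ :=
  (2 * (Real.pi : ℂ) * Complex.I)⁻¹ * ∫ θ in (-B)..B, unitPoint θ * Complex.I *
    (unitPoint θ ^ k * ((b : ℂ) / ((c : ℂ) + b * unitPoint θ)) ^ e)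

section Kernel

variable {a b c A : ℝ}

theorem kernelIntegrand_relation (hc : 0 < c) (θ : ℝ) (p : ℤ) {q : ℤ}
    (h : kernelRoot a b c θ ≠ 0 ∨ 0 ≤ q) :
    (a : ℂ) * (unitPoint θ * Complex.I * (unitPoint θ ^ p * (c : ℂ)⁻¹ * kernelRoot a b c θ ^ q)) +
      (b : ℂ) * (unitPoint θ * Complex.I *
        (unitPoint θ ^ (p + 1) * (c : ℂ)⁻¹ * kernelRoot a b c θ ^ q)) =
      -((c : ℂ) * (unitPoint θ * Complex.I *
        (unitPoint θ ^ p * (c : ℂ)⁻¹ * kernelRoot a b c θ ^ (q + 1)))) := by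
  have hc' : (c : ℂ) ≠ 0 := Complex.ofReal_ne_zero.2 hc.ne'
  have h1 : kernelRoot a b c θ ^ (q + 1) = kernelRoot a b c θ ^ q * kernelRoot a b c θ := by
    rcases h with h | h
    · exact zpow_add_one₀ h q
    · lift q to ℕ using h
      rw [← Nat.cast_succ, zpow_natCast, zpow_natCast, pow_succ]
  have h2 : (c : ℂ) * kernelRoot a b c θ = -((a : ℂ) + b * unitPoint θ) := by
    rw [kernelRoot]
    field_simp
  rw [h1, zpow_add_one₀ (unitPoint_ne_zero θ)]
  linear_combination (unitPoint θ * Complex.I *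
        (unitPoint θ ^ p * (c : ℂ)⁻¹ * kernelRoot a b c θ ^ q)) * h2

theorem continuousOn_kernelIntegrand (p : ℤ) {q : ℤ} {s : Set ℝ}
    (h : ∀ θ ∈ s, kernelRoot a b c θ ≠ 0 ∨ 0 ≤ q) :
    ContinuousOn (fun θ => unitPoint θ * Complex.I *
      (unitPoint θ ^ p * (c : ℂ)⁻¹ * kernelRoot a b c θ ^ q)) s := by
  refine (continuous_unitPoint.mul continuous_const).continuousOn.mul
    ((ContinuousOn.mul ?_ continuousOn_const).mul ?_)
  · exact (continuous_unitPoint.zpow₀ p fun θ => Or.inl (unitPoint_ne_zero θ)).continuousOn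
  · exact (continuous_kernelRoot a b c).continuousOn.zpow₀ q h

theorem integral_kernelIntegrand_relation (hc : 0 < c) (p : ℤ) {q : ℤ} {x y : ℝ}
    (h : ∀ θ ∈ Set.uIcc x y, kernelRoot a b c θ ≠ 0 ∨ 0 ≤ q) :
    (a : ℂ) * (∫ θ in x..y, unitPoint θ * Complex.I *
        (unitPoint θ ^ p * (c : ℂ)⁻¹ * kernelRoot a b c θ ^ q)) +
      (b : ℂ) * (∫ θ in x..y, unitPoint θ * Complex.I *
        (unitPoint θ ^ (p + 1) * (c : ℂ)⁻¹ * kernelRoot a b c θ ^ q)) =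
      -((c : ℂ) * ∫ θ in x..y, unitPoint θ * Complex.I *
        (unitPoint θ ^ p * (c : ℂ)⁻¹ * kernelRoot a b c θ ^ (q + 1))) := by
  rw [← intervalIntegral.integral_const_mul, ← intervalIntegral.integral_const_mul,
    ← intervalIntegral.integral_const_mul, ← intervalIntegral.integral_neg,
    ← intervalIntegral.integral_add]
  · exact intervalIntegral.integral_congr fun θ hθ => kernelIntegrand_relation hc θ p (h θ hθ)
  · exact ((continuousOn_kernelIntegrand p h).const_mul _).intervalIntegrable
  · exact ((continuousOn_kernelIntegrand (p + 1) h).const_mul _).intervalIntegrable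

/-- The kernel inverts the Kasteleyn operator. -/
theorem kernelCoeff_relation (ha : 0 < a) (hb : 0 < b) (hc : 0 < c) (hA0 : 0 < A)
    (hAπ : A < Real.pi) (hA : a ^ 2 + b ^ 2 + 2 * a * b * Real.cos A = c ^ 2) (p q : ℤ) :
    (a : ℂ) * kernelCoeff a b c p q + b * kernelCoeff a b c (p + 1) q +
      c * kernelCoeff a b c p (q + 1) = if p = -1 ∧ q = -1 then 1 else 0 := by
  have hπ : (2 * (Real.pi : ℂ) * Complex.I) ≠ 0 := Complex.two_pi_I_ne_zero
  have hc' : (c : ℂ) ≠ 0 := Complex.ofReal_ne_zero.2 hc.ne'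
  have hO : ∀ q : ℤ, ∀ θ ∈ Set.uIcc (-A) A, kernelRoot a b c θ ≠ 0 ∨ 0 ≤ q := by
    intro q θ hθ
    rw [Set.uIcc_of_le (by linarith)] at hθ
    exact Or.inl (kernelRoot_ne_zero ha hb hc hAπ hθ)
  rcases lt_trichotomy q (-1) with h | rfl | h
  · rw [kernelCoeff_of_neg ha hb hc hA0 hAπ hA p (by omega),
      kernelCoeff_of_neg ha hb hc hA0 hAπ hA (p + 1) (by omega),
      kernelCoeff_of_neg ha hb hc hA0 hAπ hA p (by omega), if_neg (by omega)]
    linear_combination (-(2 * (Real.pi : ℂ) * Complex.I)⁻¹) *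
      integral_kernelIntegrand_relation hc p (hO q)
  · have key := integral_kernelIntegrand_relation hc p (hO (-1))
    have hfull := circleIntegral_eq_add_arcs hA0 hAπ (G := fun z => z ^ p)
      (g := fun θ => unitPoint θ ^ p) (h := fun θ => unitPoint θ ^ p)
      (continuous_unitPoint.zpow₀ p fun θ => Or.inl (unitPoint_ne_zero θ)).continuousOn
      (continuous_unitPoint.zpow₀ p fun θ => Or.inl (unitPoint_ne_zero θ)).continuousOn
      (fun _ _ => rfl) (fun _ _ => rfl)
    have hscale : ∀ x y : ℝ, (∫ θ in x..y, unitPoint θ * Complex.I * unitPoint θ ^ p) =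
        (c : ℂ) * ∫ θ in x..y, unitPoint θ * Complex.I *
          (unitPoint θ ^ p * (c : ℂ)⁻¹ * kernelRoot a b c θ ^ ((-1 : ℤ) + 1)) := by
      intro x y
      rw [← intervalIntegral.integral_const_mul]
      congr 1
      ext θ
      rw [neg_add_cancel, zpow_zero]
      field_simp
    rw [circleIntegral_zpow, hscale, hscale] at hfull
    rw [kernelCoeff_of_neg ha hb hc hA0 hAπ hA p (by omega),
      kernelCoeff_of_neg ha hb hc hA0 hAπ hA (p + 1) (by omega),
      kernelCoeff_of_nonneg ha hb hc hA0 hAπ hA p (by omega)]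
    have hfin : (if p = -1 ∧ (-1 : ℤ) = -1 then (1 : ℂ) else 0) =
        (2 * (Real.pi : ℂ) * Complex.I)⁻¹ *
          if p = -1 then 2 * (Real.pi : ℂ) * Complex.I else 0 := by
      by_cases h : p = -1
      · rw [if_pos ⟨h, rfl⟩, if_pos h, inv_mul_cancel₀ hπ]
      · rw [if_neg fun h' => h h'.1, if_neg h, mul_zero]
    rw [hfin, hfull]
    linear_combination (-(2 * (Real.pi : ℂ) * Complex.I)⁻¹) * key
  · have hI : ∀ θ ∈ Set.uIcc A (2 * Real.pi - A), kernelRoot a b c θ ≠ 0 ∨ 0 ≤ q :=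
      fun θ _ => Or.inr (by omega)
    rw [kernelCoeff_of_nonneg ha hb hc hA0 hAπ hA p (by omega),
      kernelCoeff_of_nonneg ha hb hc hA0 hAπ hA (p + 1) (by omega),
      kernelCoeff_of_nonneg ha hb hc hA0 hAπ hA p (by omega), if_neg (by omega)]
    linear_combination ((2 * (Real.pi : ℂ) * Complex.I)⁻¹) *
      integral_kernelIntegrand_relation hc p hI

end Kernel

section Moments

variable {b c B : ℝ}

theorem continuousOn_arcMoment_integrand (hb : 0 < b) (hc : 0 < c) (hB : B < Real.pi)
    (e : ℕ) (k : ℤ) :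
    ContinuousOn (fun θ => unitPoint θ * Complex.I *
      (unitPoint θ ^ k * ((b : ℂ) / ((c : ℂ) + b * unitPoint θ)) ^ e)) (Set.Icc (-B) B) := by
  refine (continuous_unitPoint.mul continuous_const).continuousOn.mul (ContinuousOn.mul ?_ ?_)
  · exact (continuous_unitPoint.zpow₀ k fun θ => Or.inl (unitPoint_ne_zero θ)).continuousOn
  · refine (continuousOn_const.div ?_ fun θ hθ =>
      Complex.slitPlane_ne_zero (add_mul_unitPoint_mem_slitPlane hc hb hB hθ)).pow e
    exact (continuous_const.add (continuous_const.mul continuous_unitPoint)).continuousOn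

theorem arcMoment_succ (hb : 0 < b) (hc : 0 < c) (hB0 : 0 < B) (hB : B < Real.pi)
    (e : ℕ) (k : ℤ) :
    arcMoment b c B (e + 1) (k + 1) + (c / b : ℂ) * arcMoment b c B (e + 1) k =
      arcMoment b c B e k := by
  have hb' : (b : ℂ) ≠ 0 := Complex.ofReal_ne_zero.2 hb.ne'
  have hu : Set.uIcc (-B) B = Set.Icc (-B) B := Set.uIcc_of_le (by linarith)
  rw [arcMoment, arcMoment, arcMoment, mul_left_comm, ← mul_add,
    ← intervalIntegral.integral_const_mul, ← intervalIntegral.integral_add]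
  · congr 1
    refine intervalIntegral.integral_congr fun θ hθ => ?_
    rw [hu] at hθ
    have h0 := Complex.slitPlane_ne_zero (add_mul_unitPoint_mem_slitPlane hc hb hB hθ)
    simp only [zpow_add_one₀ (unitPoint_ne_zero θ), pow_succ]
    have : (b : ℂ) / ((c : ℂ) + b * unitPoint θ) * (unitPoint θ + c / b) = 1 := by
      field_simp
      ring
    linear_combination (unitPoint θ * Complex.I *
      (unitPoint θ ^ k * ((b : ℂ) / ((c : ℂ) + b * unitPoint θ)) ^ e)) * this
  · refine ContinuousOn.intervalIntegrable ?_
    rw [hu]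
    exact continuousOn_arcMoment_integrand hb hc hB _ _
  · refine (ContinuousOn.intervalIntegrable ?_).const_mul _
    rw [hu]
    exact continuousOn_arcMoment_integrand hb hc hB _ _

theorem arcMoment_zero_neg_one (b c B : ℝ) : arcMoment b c B 0 (-1) = B / Real.pi := by
  have hπ : (Real.pi : ℂ) ≠ 0 := Complex.ofReal_ne_zero.2 Real.pi_ne_zero
  have : ∀ θ, unitPoint θ * Complex.I * (unitPoint θ ^ (-1 : ℤ) *
      ((b : ℂ) / ((c : ℂ) + b * unitPoint θ)) ^ 0) = Complex.I := by
    intro θ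
    have := unitPoint_ne_zero θ
    rw [zpow_neg_one]
    field_simp
  rw [arcMoment]
  simp only [this, intervalIntegral.integral_const, Complex.real_smul]
  push_cast
  field_simp
  ring

theorem arcMoment_zero_of_ne (b c B : ℝ) {k : ℤ} (hk : k ≠ -1) :
    arcMoment b c B 0 k = (2 * (Real.pi : ℂ) * Complex.I)⁻¹ *
      ((unitPoint B ^ (k + 1) - unitPoint (-B) ^ (k + 1)) / (k + 1)) := by
  have hk' : (k : ℂ) + 1 ≠ 0 := by
    intro h
    exact hk (by linarith [(by exact_mod_cast h : k + 1 = 0)])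
  rw [arcMoment]
  congr 1
  have hd : ∀ θ ∈ Set.uIcc (-B) B, HasDerivAt (fun θ => unitPoint θ ^ (k + 1) / (k + 1))
      (unitPoint θ * Complex.I *
        (unitPoint θ ^ k * ((b : ℂ) / ((c : ℂ) + b * unitPoint θ)) ^ 0)) θ := by
    intro θ _
    have h := ((hasDerivAt_zpow (k + 1) (unitPoint θ)
      (Or.inl (unitPoint_ne_zero θ))).comp θ (hasDerivAt_unitPoint θ)).div_const ((k : ℂ) + 1)
    refine h.congr_deriv ?_
    rw [add_sub_cancel_right]
    push_cast
    field_simp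
  rw [intervalIntegral.integral_eq_sub_of_hasDerivAt hd, sub_div]
  refine Continuous.intervalIntegrable ?_ _ _
  simp only [pow_zero, mul_one]
  exact (continuous_unitPoint.mul continuous_const).mul
    (continuous_unitPoint.zpow₀ k fun θ => Or.inl (unitPoint_ne_zero θ))

end Moments

section LogIntegral

variable {a b r A φ : ℝ}

theorem conj_unitPoint (θ : ℝ) : (starRingEnd ℂ) (unitPoint θ) = unitPoint (-θ) := by
  rw [unitPoint, unitPoint, ← Complex.exp_conj]
  simp

theorem add_mul_unitPoint_neg (h : (a : ℂ) + b * unitPoint A = r * unitPoint φ) :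
    (a : ℂ) + b * unitPoint (-A) = r * unitPoint (-φ) := by
  simpa [conj_unitPoint] using congrArg (starRingEnd ℂ) h

theorem log_mul_unitPoint (hr : 0 < r) (h1 : -Real.pi < φ) (h2 : φ ≤ Real.pi) :
    Complex.log (r * unitPoint φ) = (Real.log r : ℂ) + φ * Complex.I := by
  rw [Complex.log_ofReal_mul hr (unitPoint_ne_zero φ), unitPoint,
    Complex.log_exp (by simpa using h1) (by simpa using h2)]

theorem hasDerivAt_add_mul_unitPoint (a b θ : ℝ) :
    HasDerivAt (fun θ => (a : ℂ) + b * unitPoint θ) (b * (unitPoint θ * Complex.I)) θ :=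
  ((hasDerivAt_unitPoint θ).const_mul (b : ℂ)).const_add (a : ℂ)

theorem integral_log_deriv_add_mul_unitPoint (ha : 0 < a) (hb : 0 < b) (hr : 0 < r)
    (hA0 : 0 < A) (hA : A < Real.pi) (hφ0 : 0 < φ) (hφ : φ < Real.pi)
    (h : (a : ℂ) + b * unitPoint A = r * unitPoint φ) :
    (∫ θ in (-A)..A, unitPoint θ * Complex.I * ((b : ℂ) / ((a : ℂ) + b * unitPoint θ))) =
      2 * φ * Complex.I := by
  have hu : Set.uIcc (-A) A = Set.Icc (-A) A := Set.uIcc_of_le (by linarith)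
  have hd : ∀ θ ∈ Set.uIcc (-A) A,
      HasDerivAt (fun θ => Complex.log ((a : ℂ) + b * unitPoint θ))
        (unitPoint θ * Complex.I * ((b : ℂ) / ((a : ℂ) + b * unitPoint θ))) θ := by
    intro θ hθ
    rw [hu] at hθ
    refine ((hasDerivAt_add_mul_unitPoint a b θ).clog_real
      (add_mul_unitPoint_mem_slitPlane ha hb hA hθ)).congr_deriv ?_
    ring
  rw [intervalIntegral.integral_eq_sub_of_hasDerivAt hd, h, add_mul_unitPoint_neg h,
    log_mul_unitPoint hr (by linarith) hφ.le, log_mul_unitPoint hr (by linarith) (by linarith)]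
  · push_cast
    ring
  · refine ContinuousOn.intervalIntegrable ?_
    rw [hu]
    simpa using continuousOn_arcMoment_integrand hb ha hA 1 0

end LogIntegral

section Triangle

variable {a b c A B φ : ℝ}

theorem sq_add_mul_cos_eq (h : (a : ℂ) + b * unitPoint A = c * unitPoint φ) :
    a ^ 2 + b ^ 2 + 2 * a * b * Real.cos A = c ^ 2 := by
  rw [← normSq_add_mul_unitPoint, h, norm_mul, norm_unitPoint, mul_one, Complex.norm_real,
    Real.norm_eq_abs, sq_abs]

theorem kernelRoot_eq_neg_unitPoint (hc : 0 < c)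
    (h : (a : ℂ) + b * unitPoint A = c * unitPoint φ) : kernelRoot a b c A = -unitPoint φ := by
  have hc' : (c : ℂ) ≠ 0 := Complex.ofReal_ne_zero.2 hc.ne'
  rw [kernelRoot, h]
  field_simp

theorem unitPoint_pi : unitPoint Real.pi = -1 := Complex.exp_pi_mul_I

theorem unitPoint_mul_inv_neg_unitPoint (hB : B = Real.pi - A + φ) :
    unitPoint A * (-unitPoint φ)⁻¹ = unitPoint (-B) := by
  have h : -B = A + -φ + -Real.pi := by linarith
  rw [h, unitPoint_add, unitPoint_add, unitPoint_neg Real.pi, unitPoint_pi, unitPoint_neg φ,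
    inv_neg, inv_neg, inv_one]
  ring

theorem hasDerivAt_zpow_mul_kernelRoot_zpow (ha : 0 < a) (hc : 0 < c) {k : ℤ}
    (hk : k ≠ -1) {θ : ℝ} (h : kernelRoot a b c θ ≠ 0 ∨ 0 ≤ -k - 2) :
    HasDerivAt (fun θ => -(unitPoint θ ^ (k + 1) * kernelRoot a b c θ ^ (-k - 1)) / ((k + 1) * a))
      (unitPoint θ * Complex.I *
        (unitPoint θ ^ k * (c : ℂ)⁻¹ * kernelRoot a b c θ ^ (-k - 2))) θ := by
  have hc' : (c : ℂ) ≠ 0 := Complex.ofReal_ne_zero.2 hc.ne'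
  have ha' : (a : ℂ) ≠ 0 := Complex.ofReal_ne_zero.2 ha.ne'
  have hk' : (k : ℂ) + 1 ≠ 0 := by
    intro h
    exact hk (by linarith [(by exact_mod_cast h : k + 1 = 0)])
  have hr : HasDerivAt (kernelRoot a b c) (-(b * (unitPoint θ * Complex.I) / c)) θ :=
    ((hasDerivAt_add_mul_unitPoint a b θ).div_const (c : ℂ)).neg
  have h1 := (hasDerivAt_zpow (k + 1) (unitPoint θ)
    (Or.inl (unitPoint_ne_zero θ))).comp θ (hasDerivAt_unitPoint θ)
  have h2 := (hasDerivAt_zpow (-k - 1) (kernelRoot a b c θ)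
    (h.imp_right fun h => by omega)).comp θ hr
  refine (((h1.mul h2).neg).div_const (((k : ℂ) + 1) * a)).congr_deriv ?_
  have h3 : kernelRoot a b c θ ^ (-k - 1) = kernelRoot a b c θ ^ (-k - 2) * kernelRoot a b c θ := by
    rw [show -k - 1 = -k - 2 + 1 by ring]
    rcases h with h | h
    · exact zpow_add_one₀ h _
    · lift -k - 2 to ℕ using h with n
      rw [← Nat.cast_succ, zpow_natCast, zpow_natCast, pow_succ]
  have h4 : (c : ℂ) * kernelRoot a b c θ = -((a : ℂ) + b * unitPoint θ) := by
    rw [kernelRoot]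
    field_simp
  simp only [Function.comp_apply]
  rw [h3, zpow_add_one₀ (unitPoint_ne_zero θ), add_sub_cancel_right,
    show -k - 1 - 1 = -k - 2 by ring]
  push_cast
  field_simp
  linear_combination (-((k : ℂ) + 1) * unitPoint θ ^ k * unitPoint θ *
    kernelRoot a b c θ ^ (-k - 2)) * h4

theorem kernelCoeff_diag_of_ne (ha : 0 < a) (hb : 0 < b) (hc : 0 < c) (hA0 : 0 < A)
    (hAπ : A < Real.pi) (h : (a : ℂ) + b * unitPoint A = c * unitPoint φ)
    (hB : B = Real.pi - A + φ) {k : ℤ} (hk : k ≠ -1) :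
    (a : ℂ) * kernelCoeff a b c k (-k - 2) = -arcMoment b c B 0 k := by
  have ha' : (a : ℂ) ≠ 0 := Complex.ofReal_ne_zero.2 ha.ne'
  have hA := sq_add_mul_cos_eq h
  have hk' : (k : ℂ) + 1 ≠ 0 := by
    intro h
    exact hk (by linarith [(by exact_mod_cast h : k + 1 = 0)])
  have hend : unitPoint A ^ (k + 1) * kernelRoot a b c A ^ (-k - 1) = unitPoint (-B) ^ (k + 1) := by
    rw [← unitPoint_mul_inv_neg_unitPoint hB, ← kernelRoot_eq_neg_unitPoint hc h, mul_zpow,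
      inv_zpow', neg_add']
  have hend' : unitPoint (-A) ^ (k + 1) * kernelRoot a b c (-A) ^ (-k - 1) =
      unitPoint B ^ (k + 1) := by
    have hB' : -B = -Real.pi - -A + -φ := by linarith
    have h1 := unitPoint_mul_inv_neg_unitPoint hB
    have h2 := congrArg (starRingEnd ℂ) h1
    simp only [map_mul, map_inv₀, map_neg, conj_unitPoint, neg_neg] at h2
    rw [← h2, ← kernelRoot_eq_neg_unitPoint hc (add_mul_unitPoint_neg h), mul_zpow,
      inv_zpow', neg_add']
  rw [arcMoment_zero_of_ne _ _ _ hk]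
  rcases lt_or_gt_of_ne hk with h1 | h1
  · have h0 : ∀ θ : ℝ, kernelRoot a b c θ ≠ 0 ∨ 0 ≤ -k - 2 := fun θ => Or.inr (by omega)
    rw [kernelCoeff_of_nonneg ha hb hc hA0 hAπ hA k (by omega),
      intervalIntegral.integral_eq_sub_of_hasDerivAt fun θ _ =>
        hasDerivAt_zpow_mul_kernelRoot_zpow ha hc hk (h0 θ)]
    · have e1 : unitPoint (2 * Real.pi - A) = unitPoint (-A) := by
        rw [sub_eq_add_neg, unitPoint_add, unitPoint_two_pi, one_mul]
      have e2 : kernelRoot a b c (2 * Real.pi - A) = kernelRoot a b c (-A) := by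
        rw [kernelRoot, kernelRoot, e1]
      simp only [e1, e2, hend, hend']
      field_simp
      ring
    · exact (continuousOn_kernelIntegrand k fun θ _ => h0 θ).intervalIntegrable
  · have h0 : ∀ θ ∈ Set.uIcc (-A) A, kernelRoot a b c θ ≠ 0 ∨ 0 ≤ -k - 2 := by
      intro θ hθ
      rw [Set.uIcc_of_le (by linarith)] at hθ
      exact Or.inl (kernelRoot_ne_zero ha hb hc hAπ hθ)
    rw [kernelCoeff_of_neg ha hb hc hA0 hAπ hA k (by omega),
      intervalIntegral.integral_eq_sub_of_hasDerivAt fun θ hθ =>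
        hasDerivAt_zpow_mul_kernelRoot_zpow ha hc hk (h0 θ hθ)]
    · simp only [hend, hend']
      field_simp
      ring
    · exact (continuousOn_kernelIntegrand k h0).intervalIntegrable

theorem kernelCoeff_zero_neg_one (ha : 0 < a) (hb : 0 < b) (hc : 0 < c) (hA0 : 0 < A)
    (hAπ : A < Real.pi) (hφ0 : 0 < φ) (hφ : φ < Real.pi)
    (h : (a : ℂ) + b * unitPoint A = c * unitPoint φ) :
    (b : ℂ) * kernelCoeff a b c 0 (-1) = φ / Real.pi := by
  have hc' : (c : ℂ) ≠ 0 := Complex.ofReal_ne_zero.2 hc.ne'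
  have hπ : (Real.pi : ℂ) ≠ 0 := Complex.ofReal_ne_zero.2 Real.pi_ne_zero
  rw [kernelCoeff_of_neg ha hb hc hA0 hAπ (sq_add_mul_cos_eq h) 0 (by omega), mul_neg,
    mul_left_comm, ← intervalIntegral.integral_const_mul]
  have : ∀ θ, (b : ℂ) * (unitPoint θ * Complex.I * (unitPoint θ ^ (0 : ℤ) * (c : ℂ)⁻¹ *
      kernelRoot a b c θ ^ (-1 : ℤ))) =
      -(unitPoint θ * Complex.I * ((b : ℂ) / ((a : ℂ) + b * unitPoint θ))) := by
    intro θ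
    rw [kernelRoot, zpow_neg_one, inv_neg, inv_div, zpow_zero]
    field_simp
  simp only [this, intervalIntegral.integral_neg]
  rw [integral_log_deriv_add_mul_unitPoint ha hb hc hA0 hAπ hφ0 hφ h]
  field_simp

theorem kernelCoeff_neg_one_neg_one (ha : 0 < a) (hb : 0 < b) (hc : 0 < c) (hA0 : 0 < A)
    (hAπ : A < Real.pi) (hφ0 : 0 < φ) (hφ : φ < Real.pi)
    (h : (a : ℂ) + b * unitPoint A = c * unitPoint φ) :
    (a : ℂ) * kernelCoeff a b c (-1) (-1) = (A - φ) / Real.pi := by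
  have hc' : (c : ℂ) ≠ 0 := Complex.ofReal_ne_zero.2 hc.ne'
  have hπ : (Real.pi : ℂ) ≠ 0 := Complex.ofReal_ne_zero.2 Real.pi_ne_zero
  have hu : Set.uIcc (-A) A = Set.Icc (-A) A := Set.uIcc_of_le (by linarith)
  rw [kernelCoeff_of_neg ha hb hc hA0 hAπ (sq_add_mul_cos_eq h) (-1) (by omega), mul_neg,
    mul_left_comm, ← intervalIntegral.integral_const_mul]
  have : Set.EqOn (fun θ => (a : ℂ) * (unitPoint θ * Complex.I * (unitPoint θ ^ (-1 : ℤ) *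
      (c : ℂ)⁻¹ * kernelRoot a b c θ ^ (-1 : ℤ))))
      (fun θ => unitPoint θ * Complex.I * ((b : ℂ) / ((a : ℂ) + b * unitPoint θ)) - Complex.I)
      (Set.uIcc (-A) A) := by
    intro θ hθ
    rw [hu] at hθ
    have h0 := Complex.slitPlane_ne_zero (add_mul_unitPoint_mem_slitPlane ha hb hAπ hθ)
    have h1 := unitPoint_ne_zero θ
    simp only [kernelRoot, zpow_neg_one, inv_neg, inv_div]
    simp only [div_eq_mul_inv]
    set X := (a : ℂ) + b * unitPoint θ with hX
    linear_combination (-Complex.I) * mul_inv_cancel₀ h0 -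
      a * Complex.I * X⁻¹ * mul_inv_cancel₀ hc' -
      a * Complex.I * X⁻¹ * c * (c : ℂ)⁻¹ * mul_inv_cancel₀ h1 + Complex.I * X⁻¹ * hX
  rw [intervalIntegral.integral_congr this, intervalIntegral.integral_sub,
    integral_log_deriv_add_mul_unitPoint ha hb hc hA0 hAπ hφ0 hφ h,
    intervalIntegral.integral_const, Complex.real_smul]
  · push_cast
    field_simp
    ring
  · refine ContinuousOn.intervalIntegrable ?_
    rw [hu]
    simpa using continuousOn_arcMoment_integrand hb ha hAπ 1 0
  · exact intervalIntegrable_const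

end Triangle

section Identification

variable {a b c A B φ : ℝ}

theorem eq_of_two_term_recurrence {r : ℂ} (hr : r ≠ 0) {f g : ℤ → ℂ} (h0 : f 0 = g 0)
    (h : ∀ k, f (k + 1) + r * f k = g (k + 1) + r * g k) (k : ℤ) : f k = g k := by
  induction k using Int.induction_on with
  | zero => exact h0
  | succ i ih => linear_combination h i - r * ih
  | pred i ih =>
    have h1 := h (-(i : ℤ) - 1)
    rw [sub_add_cancel, ih] at h1
    exact mul_left_cancel₀ hr (add_left_cancel h1)

/-- Angles of the triangle with side lengths `a, b, c`. -/
theorem exists_triangle_angles (ha : 0 < a) (hb : 0 < b) (hc : 0 < c) (habc : a < b + c)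
    (hbca : b < c + a) (hcab : c < a + b) :
    ∃ A φ : ℝ, 0 < A ∧ A < Real.pi ∧ 0 < φ ∧ φ < Real.pi ∧ φ < A ∧
      (a : ℂ) + b * unitPoint A = c * unitPoint φ := by
  have hb' : (b : ℂ) ≠ 0 := Complex.ofReal_ne_zero.2 hb.ne'
  set x : ℝ := (a ^ 2 + c ^ 2 - b ^ 2) / (2 * a * c) with hx
  have hac : 0 < 2 * a * c := by positivity
  have hx1 : -1 < x := by
    rw [hx, lt_div_iff₀ hac]
    nlinarith
  have hx2 : x < 1 := by
    rw [hx, div_lt_one hac]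
    nlinarith
  have hcos : Real.cos (Real.arccos x) = x := Real.cos_arccos hx1.le hx2.le
  have hφ0 : 0 < Real.arccos x := Real.arccos_pos.2 hx2
  have hφ : Real.arccos x < Real.pi :=
    lt_of_le_of_ne (Real.arccos_le_pi x) fun h => hx1.not_ge (Real.arccos_eq_pi.1 h)
  set φ := Real.arccos x
  have hsin : 0 < Real.sin φ := Real.sin_pos_of_pos_of_lt_pi hφ0 hφ
  set z : ℂ := ((c : ℂ) * unitPoint φ - a) / b with hz
  have hnorm : ‖z‖ = 1 := by
    have h1 : ‖(c : ℂ) * unitPoint φ - a‖ ^ 2 = b ^ 2 := by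
      have h2 := normSq_add_mul_unitPoint (-a) c φ
      rw [hcos, Complex.ofReal_neg, neg_add_eq_sub] at h2
      rw [h2, hx]
      field_simp
      ring
    rw [hz, norm_div, Complex.norm_real, Real.norm_of_nonneg hb.le,
      (sq_eq_sq₀ (norm_nonneg _) hb.le).1 h1, div_self hb.ne']
  have hzA : unitPoint z.arg = z := by
    have := Complex.norm_mul_exp_arg_mul_I z
    rwa [hnorm, Complex.ofReal_one, one_mul] at this
  have heq : (a : ℂ) + b * unitPoint z.arg = c * unitPoint φ := by
    rw [hzA, hz]
    field_simp
    ring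
  have him : b * Real.sin z.arg = c * Real.sin φ := by
    have := congrArg Complex.im heq
    simpa [unitPoint_im] using this
  have hsA : 0 < Real.sin z.arg := by
    have : 0 < b * Real.sin z.arg := by rw [him]; positivity
    exact (mul_pos_iff_of_pos_left hb).1 this
  have hA0 : 0 < z.arg := by
    by_contra! h
    exact hsA.not_ge (Real.sin_nonpos_of_nonpos_of_neg_pi_le h (Complex.neg_pi_lt_arg z).le)
  have hA : z.arg < Real.pi :=
    lt_of_le_of_ne (Complex.arg_le_pi z) fun h => by simp [h] at hsA
  refine ⟨z.arg, φ, hA0, hA, hφ0, hφ, ?_, heq⟩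
  have h3 : a * Real.sin φ = b * Real.sin (z.arg - φ) := by
    have h4 := congrArg (fun t => (t * unitPoint (-φ)).im) heq
    simp only [add_mul, mul_assoc, ← unitPoint_add, ← sub_eq_add_neg, sub_self] at h4
    simp [unitPoint_im] at h4
    linarith
  have h5 : 0 < Real.sin (z.arg - φ) := by
    have : 0 < b * Real.sin (z.arg - φ) := by rw [← h3]; positivity
    exact (mul_pos_iff_of_pos_left hb).1 this
  by_contra! h
  exact h5.not_ge (Real.sin_nonpos_of_nonpos_of_neg_pi_le (by linarith) (by linarith))

theorem add_mul_unitPoint_dual (h : (a : ℂ) + b * unitPoint A = c * unitPoint φ)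
    (hB : B = Real.pi - A + φ) : (c : ℂ) + b * unitPoint B = a * unitPoint φ := by
  have h1 := add_mul_unitPoint_neg h
  have h2 : unitPoint (-φ) * unitPoint φ = 1 := by
    rw [unitPoint_neg, inv_mul_cancel₀ (unitPoint_ne_zero φ)]
  rw [hB, sub_eq_add_neg, unitPoint_add, unitPoint_add, unitPoint_pi]
  linear_combination (-unitPoint φ) * h1 - c * h2

theorem mul_kernelCoeff_eq_arcMoment_one (ha : 0 < a) (hb : 0 < b) (hc : 0 < c) (hA0 : 0 < A)
    (hAπ : A < Real.pi) (hφ0 : 0 < φ) (hφ : φ < Real.pi) (hB0 : 0 < B) (hBπ : B < Real.pi)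
    (h : (a : ℂ) + b * unitPoint A = c * unitPoint φ) (hB : B = Real.pi - A + φ) (k : ℤ) :
    (b : ℂ) * kernelCoeff a b c k (-k - 1) = arcMoment b c B 1 k := by
  have hb' : (b : ℂ) ≠ 0 := Complex.ofReal_ne_zero.2 hb.ne'
  have hc' : (c : ℂ) ≠ 0 := Complex.ofReal_ne_zero.2 hc.ne'
  have hπ : (Real.pi : ℂ) ≠ 0 := Complex.ofReal_ne_zero.2 Real.pi_ne_zero
  refine eq_of_two_term_recurrence (f := fun k => (b : ℂ) * kernelCoeff a b c k (-k - 1))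
    (g := arcMoment b c B 1) (div_ne_zero hc' hb') ?_ (fun k => ?_) k
  · have h1 := integral_log_deriv_add_mul_unitPoint hc hb ha hB0 hBπ hφ0 hφ
      (add_mul_unitPoint_dual h hB)
    simp only [neg_zero, zero_sub]
    rw [kernelCoeff_zero_neg_one ha hb hc hA0 hAπ hφ0 hφ h, arcMoment]
    simp only [zpow_zero, one_mul, pow_one]
    rw [h1]
    field_simp
  · rw [arcMoment_succ hb hc hB0 hBπ 0 k]
    have hrel := kernelCoeff_relation ha hb hc hA0 hAπ (sq_add_mul_cos_eq h) k (-k - 2)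
    rw [show -k - 2 + 1 = -k - 1 by ring] at hrel
    rw [show -(k + 1) - 1 = -k - 2 by ring, ← mul_assoc, div_mul_cancel₀ _ hb']
    by_cases hk : k = -1
    · subst hk
      rw [if_pos (by norm_num)] at hrel
      have hd := kernelCoeff_neg_one_neg_one ha hb hc hA0 hAπ hφ0 hφ h
      rw [show -(-1 : ℤ) - 2 = -1 by norm_num, neg_add_cancel,
        show -(-1 : ℤ) - 1 = 0 by norm_num] at hrel
      rw [arcMoment_zero_neg_one, hB]
      push_cast
      have : ((Real.pi : ℂ) - A + φ) / Real.pi = 1 - (A - φ) / Real.pi := by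
        field_simp
        ring
      linear_combination hrel - hd - this
    · rw [if_neg (by simp [hk])] at hrel
      linear_combination hrel - kernelCoeff_diag_of_ne ha hb hc hA0 hAπ h hB hk

theorem arcMoment_two_zero (ha : 0 < a) (hb : 0 < b) (hc : 0 < c) (hB0 : 0 < B)
    (hBπ : B < Real.pi) (h : (c : ℂ) + b * unitPoint B = a * unitPoint φ) :
    arcMoment b c B 2 0 = (2 * (Real.pi : ℂ) * Complex.I)⁻¹ *
      (b / a * (unitPoint φ - unitPoint (-φ))) := by
  have ha' : (a : ℂ) ≠ 0 := Complex.ofReal_ne_zero.2 ha.ne'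
  have hu : Set.uIcc (-B) B = Set.Icc (-B) B := Set.uIcc_of_le (by linarith)
  have hd : ∀ θ ∈ Set.uIcc (-B) B,
      HasDerivAt (fun θ => -((b : ℂ) * ((c : ℂ) + b * unitPoint θ)⁻¹))
        (unitPoint θ * Complex.I * (unitPoint θ ^ (0 : ℤ) *
          ((b : ℂ) / ((c : ℂ) + b * unitPoint θ)) ^ 2)) θ := by
    intro θ hθ
    rw [hu] at hθ
    have h0 := Complex.slitPlane_ne_zero (add_mul_unitPoint_mem_slitPlane hc hb hBπ hθ)
    refine (((hasDerivAt_add_mul_unitPoint c b θ).fun_inv h0).const_mul (b : ℂ)).neg.congr_deriv ?_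
    rw [zpow_zero]
    field_simp
  rw [arcMoment, intervalIntegral.integral_eq_sub_of_hasDerivAt hd, h, add_mul_unitPoint_neg h,
    unitPoint_neg]
  · have := unitPoint_ne_zero φ
    field_simp
    ring
  · refine ContinuousOn.intervalIntegrable ?_
    rw [hu]
    exact continuousOn_arcMoment_integrand hb hc hBπ 2 0

theorem kernelCoeff_zero_zero (ha : 0 < a) (hb : 0 < b) (hc : 0 < c) (hA0 : 0 < A)
    (hAπ : A < Real.pi) (h : (a : ℂ) + b * unitPoint A = c * unitPoint φ) :
    kernelCoeff a b c 0 0 = -((2 * (Real.pi : ℂ) * Complex.I)⁻¹ *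
      (b : ℂ)⁻¹ * (unitPoint φ - unitPoint (-φ))) := by
  have hc' : (c : ℂ) ≠ 0 := Complex.ofReal_ne_zero.2 hc.ne'
  have hb' : (b : ℂ) ≠ 0 := Complex.ofReal_ne_zero.2 hb.ne'
  have hd : ∀ θ ∈ Set.uIcc A (2 * Real.pi - A), HasDerivAt (fun θ => unitPoint θ / c)
        (unitPoint θ * Complex.I * (unitPoint θ ^ (0 : ℤ) * (c : ℂ)⁻¹ *
          kernelRoot a b c θ ^ (0 : ℤ))) θ := by
    intro θ _
    refine ((hasDerivAt_unitPoint θ).div_const (c : ℂ)).congr_deriv ?_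
    rw [zpow_zero, zpow_zero]
    field_simp
  have e1 : unitPoint (2 * Real.pi - A) = unitPoint (-A) := by
    rw [sub_eq_add_neg, unitPoint_add, unitPoint_two_pi, one_mul]
  rw [kernelCoeff_of_nonneg ha hb hc hA0 hAπ (sq_add_mul_cos_eq h) 0 le_rfl,
    intervalIntegral.integral_eq_sub_of_hasDerivAt hd
      (continuousOn_kernelIntegrand 0 fun _ _ => Or.inr le_rfl).intervalIntegrable, e1]
  have h1 := add_mul_unitPoint_neg h
  field_simp
  linear_combination h1 - h

theorem mul_kernelCoeff_eq_arcMoment_two (ha : 0 < a) (hb : 0 < b) (hc : 0 < c) (hA0 : 0 < A)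
    (hAπ : A < Real.pi) (hφ0 : 0 < φ) (hφ : φ < Real.pi) (hB0 : 0 < B) (hBπ : B < Real.pi)
    (h : (a : ℂ) + b * unitPoint A = c * unitPoint φ) (hB : B = Real.pi - A + φ) (k : ℕ) :
    -((b : ℂ) ^ 2 / a * kernelCoeff a b c k (-k)) = arcMoment b c B 2 k := by
  have ha' : (a : ℂ) ≠ 0 := Complex.ofReal_ne_zero.2 ha.ne'
  have hb' : (b : ℂ) ≠ 0 := Complex.ofReal_ne_zero.2 hb.ne'
  induction k with
  | zero =>
    simp only [Nat.cast_zero, neg_zero]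
    rw [arcMoment_two_zero ha hb hc hB0 hBπ (add_mul_unitPoint_dual h hB),
      kernelCoeff_zero_zero ha hb hc hA0 hAπ h]
    field_simp
  | succ k ih =>
    have h1 := mul_kernelCoeff_eq_arcMoment_one ha hb hc hA0 hAπ hφ0 hφ hB0 hBπ h hB k
    have h2 := arcMoment_succ hb hc hB0 hBπ 1 k
    have h3 := kernelCoeff_relation ha hb hc hA0 hAπ (sq_add_mul_cos_eq h) k (-k - 1)
    rw [if_neg (by omega), sub_add_cancel] at h3
    rw [← h1, ← ih] at h2
    push_cast
    rw [show -((k : ℤ) + 1) = -k - 1 by ring]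
    field_simp at h2 ⊢
    linear_combination (-b) * h3 - h2

end Identification

section BorderedToeplitz

/-- The `(n + 1) × (n + 1)` Toeplitz matrix with symbol `τ`, whose last column is replaced by the
one of the Toeplitz matrix with symbol `ρ`. -/
def borderedToeplitz {R : Type*} (τ ρ : ℤ → R) (n : ℕ) : Matrix (Fin (n + 1)) (Fin (n + 1)) R :=
  Matrix.of fun i j => if (j : ℕ) < n then τ ((j : ℕ) - (i : ℕ)) else ρ ((n : ℤ) - (i : ℕ))

theorem borderedToeplitz_eq_updateCol {R : Type*} (τ ρ ρ' : ℤ → R) (n : ℕ) :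
    borderedToeplitz τ ρ n = (borderedToeplitz τ ρ' n).updateCol (Fin.last n)
      (fun i => ρ ((n : ℤ) - (i : ℕ))) := by
  ext i j
  rw [Matrix.updateCol_apply]
  by_cases h : j = Fin.last n
  · simp [borderedToeplitz, h]
  · simp [borderedToeplitz, h, Fin.val_lt_last h]

variable {R : Type*} [CommRing R]

theorem det_borderedToeplitz_self {τ σ : ℤ → R} {r : R} (h : ∀ k, σ (k + 1) + r * σ k = τ k)
    (n : ℕ) :
    (borderedToeplitz τ τ n).det =
      (borderedToeplitz τ (fun k => σ (k + 1)) n).det + r * (borderedToeplitz τ σ n).det := by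
  have h1 : (fun i : Fin (n + 1) => τ ((n : ℤ) - (i : ℕ))) =
      (fun i : Fin (n + 1) => σ ((n : ℤ) - (i : ℕ) + 1)) +
        r • (fun i : Fin (n + 1) => σ ((n : ℤ) - (i : ℕ))) := by
    ext i
    simp [h]
  rw [borderedToeplitz_eq_updateCol τ τ τ, h1, Matrix.det_updateCol_add,
    Matrix.det_updateCol_smul, ← borderedToeplitz_eq_updateCol,
    ← borderedToeplitz_eq_updateCol τ (fun k => σ (k + 1))]

theorem det_updateRow_single_borderedToeplitz (τ σ : ℤ → R) (n : ℕ) :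
    ((borderedToeplitz τ σ (n + 1)).updateRow (Fin.last (n + 1))
      (Pi.single (Fin.last n).castSucc 1)).det =
      -(borderedToeplitz τ (fun k => σ (k + 1)) n).det := by
  rw [← Matrix.adjugate_apply, Matrix.adjugate_fin_succ_eq_det_submatrix]
  have h1 : (borderedToeplitz τ σ (n + 1)).submatrix (Fin.last (n + 1)).succAbove
      (Fin.last n).castSucc.succAbove = borderedToeplitz τ (fun k => σ (k + 1)) n := by
    ext i j
    by_cases h : j = Fin.last n
    · simp [borderedToeplitz, h]
      ring_nf
    · have hj : (j : ℕ) < n := Fin.val_lt_last h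
      have hj' : (Fin.last n).castSucc.succAbove j = j.castSucc := by
        rw [Fin.succAbove_of_castSucc_lt]
        exact Fin.castSucc_lt_castSucc_iff.2 (Fin.lt_last_iff_ne_last.2 h)
      simp [borderedToeplitz, hj', hj, hj.le]
  rw [h1]
  simp only [Fin.val_last, Fin.val_castSucc]
  rw [show n + 1 + n = 2 * n + 1 by ring, Odd.neg_one_pow ⟨n, rfl⟩, neg_one_mul]

theorem det_updateRow_borderedToeplitz (τ σ : ℤ → R) (r : R) (n : ℕ) :
    ((borderedToeplitz τ σ (n + 1)).updateRow (Fin.last (n + 1))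
      (-(Pi.single (Fin.last n).castSucc 1) +
        borderedToeplitz τ σ (n + 1) (Fin.last n).castSucc +
        r • borderedToeplitz τ σ (n + 1) (Fin.last (n + 1)))).det =
      (borderedToeplitz τ (fun k => σ (k + 1)) n).det + r * (borderedToeplitz τ σ (n + 1)).det := by
  have hne : (Fin.last n).castSucc ≠ Fin.last (n + 1) := (Fin.castSucc_lt_last _).ne
  rw [Matrix.det_updateRow_add, Matrix.det_updateRow_add, Matrix.det_updateRow_smul,
    Matrix.updateRow_eq_self, ← neg_one_smul R, Matrix.det_updateRow_smul,
    det_updateRow_single_borderedToeplitz, Matrix.det_zero_of_row_eq hne.symm]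
  · ring
  · ext j
    simp [Matrix.updateRow_apply, hne]

theorem det_conj_diagonal_of_ne_zero {K ι : Type*} [Field K] [Fintype ι] {v : ι → K}
    (hv : ∀ i, v i ≠ 0) (A : Matrix ι ι K) [DecidableEq ι] :
    (Matrix.of fun i j => v i * ((v j)⁻¹ * A i j)).det = A.det := by
  have h := Matrix.det_mul_column v (Matrix.of fun i j => (v j)⁻¹ * A i j)
  simp only [Matrix.of_apply] at h
  rw [h, Matrix.det_mul_row (fun j => (v j)⁻¹), ← mul_assoc, ← Finset.prod_mul_distrib,
    Finset.prod_eq_one fun i _ => mul_inv_cancel₀ (hv i), one_mul]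

end BorderedToeplitz

section Increment

variable {a b c A B φ : ℝ}

theorem D_eq_det_borderedToeplitz (ha : 0 < a) (hb : 0 < b) (hc : 0 < c) (hA0 : 0 < A)
    (hAπ : A < Real.pi) (hA : (a : ℂ) + b * unitPoint A = c * unitPoint φ)
    (hτ : ∀ k : ℤ, b * kernelCoeff a b c k (-k - 1) = arcMoment b c B 1 k)
    (hσ : ∀ k : ℕ, -((b : ℂ) ^ 2 / a * kernelCoeff a b c k (-k)) = arcMoment b c B 2 k)
    (hB0 : 0 < B) (hB : B < Real.pi) (m : ℕ) :
    D a b c m = (c / b : ℂ) *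
      ((borderedToeplitz (arcMoment b c B 1) (arcMoment b c B 2) m).det -
        (borderedToeplitz (arcMoment b c B 1) (arcMoment b c B 2) (m + 1)).det) := by
  have ha' : (a : ℂ) ≠ 0 := Complex.ofReal_ne_zero.2 ha.ne'
  have hb' : (b : ℂ) ≠ 0 := Complex.ofReal_ne_zero.2 hb.ne'
  have hrec := arcMoment_succ hb hc hB0 hB 1
  norm_num at hrec
  set τ := arcMoment b c B 1
  set σ := arcMoment b c B 2
  have hT : (Matrix.of fun i j : Fin (m + 1) =>
      (b : ℂ) * Kinv a b c 0 (-((i : ℕ) : ℤ)) 0 (-((j : ℕ) : ℤ))) = borderedToeplitz τ τ m := by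
    ext i j
    have hk : (b : ℂ) * Kinv a b c 0 (-((i : ℕ) : ℤ)) 0 (-((j : ℕ) : ℤ)) =
        τ ((j : ℕ) - (i : ℕ)) := by
      rw [Kinv_eq_kernelCoeff, ← hτ]
      ring_nf
    rcases (Nat.lt_succ_iff.1 j.2).lt_or_eq with h | h
    · simp [borderedToeplitz, hk, h]
    · simp [borderedToeplitz, hk, ← h]
  have hL : (Matrix.of fun i j : Fin (m + 2) =>
      (b : ℂ) * Kinv a b c
          (if (i : ℕ) ≤ m then 0 else 1)
          (if (i : ℕ) ≤ m then -((i : ℕ) : ℤ) else -(m : ℤ) - 1)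
          (if (j : ℕ) ≤ m then 0 else 1)
          (if (j : ℕ) ≤ m then -((j : ℕ) : ℤ) else -(m : ℤ) - 1)) =
      Matrix.of fun i j : Fin (m + 2) => (if (i : ℕ) ≤ m then (1 : ℂ) else -(b / a)) *
        ((if (j : ℕ) ≤ m then (1 : ℂ) else -(b / a))⁻¹ *
          ((borderedToeplitz τ σ (m + 1)).updateRow (Fin.last (m + 1))
      (-(Pi.single (Fin.last m).castSucc 1) +
        borderedToeplitz τ σ (m + 1) (Fin.last m).castSucc +
        (c / b : ℂ) • borderedToeplitz τ σ (m + 1) (Fin.last (m + 1)))) i j) := by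
    have hle : ∀ i : Fin (m + 1), (i : ℕ) ≤ m := fun i => Nat.lt_succ_iff.1 i.2
    ext i j
    refine Fin.lastCases ?_ (fun i => ?_) i <;> refine Fin.lastCases ?_ (fun j => ?_) j
    · have h1 : (b : ℂ) * kernelCoeff a b c 0 (-1) = σ 1 + c / b * σ 0 := by
        have h0 := hτ 0
        rw [← hrec] at h0
        simpa using h0
      simp [borderedToeplitz, Matrix.updateRow_apply, Kinv_eq_kernelCoeff, h1]
      field_simp
    · have h1 := kernelCoeff_relation ha hb hc hA0 hAπ (sq_add_mul_cos_eq hA)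
        ((j : ℕ) - (m : ℤ) - 1) (-((j : ℕ) - (m : ℤ) - 1) - 2)
      have h2 := hτ ((j : ℕ) - (m : ℤ))
      have h3 := hτ ((j : ℕ) - ((m : ℤ) + 1))
      have h4 : (if (j : ℕ) - (m : ℤ) - 1 = -1 ∧ -((j : ℕ) - (m : ℤ) - 1) - 2 = -1 then (1 : ℂ)
          else 0) = (Pi.single (Fin.last m).castSucc 1 : Fin (m + 2) → ℂ) j.castSucc := by
        rw [Pi.single_apply]
        refine if_congr ?_ rfl rfl
        rw [Fin.castSucc_inj, Fin.ext_iff, Fin.val_last]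
        omega
      rw [h4] at h1
      simp [borderedToeplitz, Matrix.updateRow_apply, Kinv_eq_kernelCoeff, hle, ← h2, ← h3, ← h1]
      field_simp
      ring_nf
    · have h1 := hσ (m + 1 - i)
      rw [Nat.cast_sub ((hle i).trans m.le_succ)] at h1
      push_cast at h1
      simp [borderedToeplitz, Matrix.updateRow_apply, Kinv_eq_kernelCoeff, hle, ← h1]
      field_simp
      ring_nf
    · simp [borderedToeplitz, Matrix.updateRow_apply, Kinv_eq_kernelCoeff, hle, ← hτ]
      left
      ring_nf
  rw [D, hT, hL, det_conj_diagonal_of_ne_zero, det_updateRow_borderedToeplitz,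
    det_borderedToeplitz_self hrec]
  · ring
  · intro i
    split_ifs
    · exact one_ne_zero
    · exact neg_ne_zero.2 (div_ne_zero hb' ha')

end Increment

section Decay

open Polynomial

variable {B : ℝ}

theorem exists_monic_eval_unitPoint_eq {m s : ℝ}
    (h : ∀ θ ∈ Set.Icc (-B) B, |2 * Real.cos θ - m| ≤ 2 * s) (hs : 0 < s) (k : ℕ) :
    ∃ Q : ℂ[X], Q.Monic ∧ Q.natDegree = 2 ^ (k + 1) ∧
      ∀ θ ∈ Set.Icc (-B) B, ∃ y : ℝ, |y| ≤ 2 ∧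
        Q.eval (unitPoint θ) = (s * unitPoint θ) ^ 2 ^ k * y := by
  induction k with
  | zero =>
    refine ⟨X ^ 2 - C (m : ℂ) * X + 1, by monicity!, by compute_degree!, fun θ hθ =>
      ⟨(2 * Real.cos θ - m) / s, ?_, ?_⟩⟩
    · rw [abs_div, abs_of_pos hs, div_le_iff₀ hs]
      exact h θ hθ
    · have hs' : (s : ℂ) ≠ 0 := Complex.ofReal_ne_zero.2 hs.ne'
      have h1 : unitPoint θ ^ 2 + 1 = 2 * (Real.cos θ : ℂ) * unitPoint θ := by
        have h2 : unitPoint θ * unitPoint (-θ) = 1 := by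
          rw [← unitPoint_add, add_neg_cancel]
          simp [unitPoint]
        have h3 : unitPoint θ + unitPoint (-θ) = 2 * (Real.cos θ : ℂ) := by
          rw [← conj_unitPoint, Complex.add_conj, unitPoint_re]
          push_cast
          rfl
        linear_combination unitPoint θ * h3 - h2
      simp only [eval_add, eval_sub, eval_mul, eval_pow, eval_X, eval_C, eval_one]
      push_cast at h1 ⊢
      field_simp
      linear_combination h1
  | succ k ih =>
    obtain ⟨Q, hQ, hdeg, hy⟩ := ih
    have hlt : (C (2 * (s : ℂ) ^ 2 ^ (k + 1)) * X ^ 2 ^ (k + 1)).natDegree < (Q ^ 2).natDegree := by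
      rw [hQ.natDegree_pow, hdeg]
      exact (natDegree_C_mul_X_pow_le _ _).trans_lt
        (lt_mul_of_one_lt_left (pow_pos two_pos _) one_lt_two)
    refine ⟨Q ^ 2 - C (2 * (s : ℂ) ^ 2 ^ (k + 1)) * X ^ 2 ^ (k + 1),
      (hQ.pow 2).sub_of_left (degree_lt_degree hlt), ?_, fun θ hθ => ?_⟩
    · rw [natDegree_sub_eq_left_of_natDegree_lt hlt, hQ.natDegree_pow, hdeg]
      ring
    · obtain ⟨y, hy2, hQy⟩ := hy θ hθ
      refine ⟨y ^ 2 - 2, ?_, ?_⟩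
      · have := sq_le_sq' (abs_le.1 hy2).1 (abs_le.1 hy2).2
        rw [abs_le]
        constructor <;> nlinarith [sq_nonneg y]
      · simp only [eval_sub, eval_mul, eval_pow, eval_X, eval_C, hQy]
        push_cast
        rw [mul_pow (_ ^ 2 ^ k), ← pow_mul, ← pow_succ]
        ring

/-- The logarithmic capacity of a proper arc of the unit circle is less than one: there are monic
polynomials of every degree which are geometrically small on the arc. -/
theorem exists_monic_norm_eval_unitPoint_le (hB0 : 0 < B) (hB : B < Real.pi) :
    ∃ (p : ℕ → ℂ[X]) (K r : ℝ), 0 < K ∧ 0 < r ∧ r < 1 ∧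
      (∀ i, (p i).natDegree = i) ∧ (∀ i, (p i).Monic) ∧
      ∀ i, ∀ θ ∈ Set.Icc (-B) B, ‖(p i).eval (unitPoint θ)‖ ≤ K * r ^ i := by
  set s : ℝ := (1 - Real.cos B) / 2 with hs
  have hcos1 : Real.cos B < 1 := by
    rw [← Real.cos_zero]
    exact Real.cos_lt_cos_of_nonneg_of_le_pi le_rfl hB.le hB0
  have hcos2 : -1 < Real.cos B := by
    rw [← Real.cos_pi]
    exact Real.cos_lt_cos_of_nonneg_of_le_pi hB0.le le_rfl hB
  have hs0 : 0 < s := by rw [hs]; linarith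
  have hs1 : s < 1 := by rw [hs]; linarith
  have hcos : ∀ θ ∈ Set.Icc (-B) B, |2 * Real.cos θ - (1 + Real.cos B)| ≤ 2 * s := by
    intro θ hθ
    have h1 : Real.cos B ≤ Real.cos θ := by
      rw [← Real.cos_abs θ]
      exact Real.cos_le_cos_of_nonneg_of_le_pi (abs_nonneg θ) hB.le (abs_le.2 hθ)
    rw [abs_le, hs]
    constructor <;> linarith [Real.cos_le_one θ]
  obtain ⟨k, hk⟩ : ∃ k : ℕ, s ^ k < 1 / 2 := exists_pow_lt_of_lt_one (by norm_num) hs1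
  obtain ⟨q, hq, hdeg, hy⟩ := exists_monic_eval_unitPoint_eq hcos hs0 k
  set d := 2 ^ (k + 1)
  have hd : 0 < d := pow_pos two_pos _
  set ρ : ℝ := s ^ 2 ^ k * 2
  have hρ0 : 0 < ρ := by positivity
  have hρ1 : ρ < 1 := by
    have : s ^ 2 ^ k ≤ s ^ k := pow_le_pow_of_le_one hs0.le hs1.le Nat.lt_two_pow_self.le
    simp only [ρ]
    linarith
  have hqρ : ∀ θ ∈ Set.Icc (-B) B, ‖q.eval (unitPoint θ)‖ ≤ ρ := by
    intro θ hθ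
    obtain ⟨y, hy2, hqy⟩ := hy θ hθ
    rw [hqy, norm_mul, norm_pow, norm_mul, norm_unitPoint, Complex.norm_real, Complex.norm_real,
      Real.norm_of_nonneg hs0.le, mul_one, Real.norm_eq_abs]
    exact mul_le_mul_of_nonneg_left hy2 (by positivity)
  set r : ℝ := ρ ^ ((d : ℝ)⁻¹)
  have hr0 : 0 < r := Real.rpow_pos_of_pos hρ0 _
  have hrd : r ^ d = ρ := Real.rpow_inv_natCast_pow hρ0.le hd.ne'
  have hr1 : r < 1 := Real.rpow_lt_one hρ0.le hρ1 (by positivity)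
  refine ⟨fun i => q ^ (i / d) * X ^ (i % d), (r ^ d)⁻¹, r, by positivity, hr0, hr1,
    fun i => ?_, fun i => (hq.pow _).mul (monic_X_pow _), fun i θ hθ => ?_⟩
  · rw [(hq.pow _).natDegree_mul (monic_X_pow _), hq.natDegree_pow, natDegree_X_pow, hdeg]
    exact Nat.div_add_mod' i d
  · rw [eval_mul, eval_pow, eval_pow, eval_X, norm_mul, norm_pow, norm_pow, norm_unitPoint,
      one_pow, mul_one, inv_mul_eq_div, le_div_iff₀ (by positivity)]
    calc ‖q.eval (unitPoint θ)‖ ^ (i / d) * r ^ d ≤ (r ^ d) ^ (i / d) * r ^ (i % d) := by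
          refine mul_le_mul ?_ ?_ (by positivity) (by positivity)
          · rw [hrd]
            exact pow_le_pow_left₀ (norm_nonneg _) (hqρ θ hθ) _
          · exact pow_le_pow_of_le_one hr0.le hr1.le (Nat.mod_lt i hd).le
      _ = r ^ i := by rw [← pow_mul, ← pow_add, Nat.div_add_mod]

theorem norm_det_integral_le {p : ℕ → ℂ[X]} {K r C : ℝ} (hB0 : 0 < B) (hr : 0 < r)
    (hdeg : ∀ i, (p i).natDegree = i) (hmonic : ∀ i, (p i).Monic)
    (hp : ∀ i, ∀ θ ∈ Set.Icc (-B) B, ‖(p i).eval (unitPoint θ)‖ ≤ K * r ^ i)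
    {n : ℕ} {g : Fin n → ℝ → ℂ} (hg : ∀ j, ContinuousOn (g j) (Set.Icc (-B) B))
    (hgC : ∀ j, ∀ θ ∈ Set.Icc (-B) B, ‖g j θ‖ ≤ C) :
    ‖(Matrix.of fun i j : Fin n => ∫ θ in (-B)..B, unitPoint (-θ) ^ (i : ℕ) * g j θ).det‖ ≤
      n.factorial * (K * C * (2 * B)) ^ n * ∏ i ∈ Finset.range n, r ^ i := by
  have hu : Set.uIcc (-B) B = Set.Icc (-B) B := Set.uIcc_of_le (by linarith)
  set M : Matrix (Fin n) (Fin n) ℂ :=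
    Matrix.of fun i j : Fin n => ∫ θ in (-B)..B, unitPoint (-θ) ^ (i : ℕ) * g j θ
  set N : Matrix (Fin n) (Fin n) ℂ :=
    Matrix.of fun i j : Fin n => ∫ θ in (-B)..B, (p i).eval (unitPoint (-θ)) * g j θ
  have hN : (Matrix.of fun i j : Fin n => (p j).coeff i).transpose * M = N := by
    ext i j
    simp only [Matrix.mul_apply, Matrix.transpose_apply, Matrix.of_apply, M, N]
    simp only [← intervalIntegral.integral_const_mul]
    rw [← intervalIntegral.integral_finsetSum]
    · congr 1
      ext θ
      rw [eval_eq_sum_range' (n := n) (by rw [hdeg]; exact i.2), Finset.sum_mul,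
        ← Fin.sum_univ_eq_sum_range (fun l => (p i).coeff l * unitPoint (-θ) ^ l * g j θ)]
      simp only [mul_assoc]
    · intro l _
      refine ContinuousOn.intervalIntegrable ?_
      rw [hu]
      have := (continuous_unitPoint.comp continuous_neg).continuousOn (s := Set.Icc (-B) B)
      exact continuousOn_const.mul ((this.pow _).mul (hg j))
  have hdet : M.det = N.det := by
    rw [← hN, Matrix.det_mul, Matrix.det_transpose,
      Matrix.det_matrixOfPolynomials (fun j : Fin n => p j) (fun j => hdeg j) (fun j => hmonic j),
      one_mul]
  have hNij : ∀ i j : Fin n, ‖N i j‖ ≤ r ^ (i : ℕ) * (K * C * (2 * B)) := by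
    intro i j
    have h1 : ‖N i j‖ ≤ (K * r ^ (i : ℕ) * C) * |B - -B| := by
      refine intervalIntegral.norm_integral_le_of_norm_le_const fun θ hθ => ?_
      rw [Set.uIoc_of_le (by linarith)] at hθ
      have hθ' : θ ∈ Set.Icc (-B) B := Set.Ioc_subset_Icc_self hθ
      have h2 := hp i (-θ) ⟨by linarith [hθ'.2], by linarith [hθ'.1]⟩
      rw [norm_mul]
      exact mul_le_mul h2 (hgC j θ hθ') (norm_nonneg _) ((norm_nonneg _).trans h2)
    refine h1.trans_eq ?_
    rw [abs_of_pos (by linarith)]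
    ring
  have hscale : N = Matrix.of fun i j : Fin n => (r : ℂ) ^ (i : ℕ) *
      Matrix.of (fun i j : Fin n => ((r : ℂ) ^ (i : ℕ))⁻¹ * N i j) i j := by
    ext i j
    rw [Matrix.of_apply, Matrix.of_apply, mul_inv_cancel_left₀]
    exact pow_ne_zero _ (Complex.ofReal_ne_zero.2 hr.ne')
  have hle : ‖(Matrix.of fun i j : Fin n => ((r : ℂ) ^ (i : ℕ))⁻¹ * N i j).det‖ ≤
      (Fintype.card (Fin n)).factorial • (K * C * (2 * B)) ^ Fintype.card (Fin n) := by
    refine Matrix.det_le (abv := NormedField.toAbsoluteValue ℂ) fun i j => ?_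
    change ‖((r : ℂ) ^ (i : ℕ))⁻¹ * N i j‖ ≤ _
    rw [norm_mul, norm_inv, norm_pow, Complex.norm_real, Real.norm_of_nonneg hr.le,
      inv_mul_le_iff₀ (by positivity)]
    exact hNij i j
  rw [Fintype.card_fin, nsmul_eq_mul] at hle
  rw [hdet, hscale, Matrix.det_mul_column, norm_mul, mul_comm,
    Fin.prod_univ_eq_prod_range (fun i => (r : ℂ) ^ i) n, norm_prod]
  simp only [norm_pow, Complex.norm_real, Real.norm_of_nonneg hr.le]
  exact mul_le_mul_of_nonneg_right hle (Finset.prod_nonneg fun i _ => by positivity)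

theorem summable_factorial_mul_pow_mul_prod {W r : ℝ} (hW : 0 < W) (hr0 : 0 < r) (hr1 : r < 1) :
    Summable fun n : ℕ => (n.factorial : ℝ) * W ^ n * ∏ i ∈ Finset.range n, r ^ i := by
  have hpos : ∀ n : ℕ, 0 < (n.factorial : ℝ) * W ^ n * ∏ i ∈ Finset.range n, r ^ i := fun n =>
    mul_pos (by positivity) (Finset.prod_pos fun i _ => by positivity)
  refine summable_of_ratio_test_tendsto_lt_one zero_lt_one
    (Filter.Eventually.of_forall fun n => (hpos n).ne') ?_
  have h1 : Filter.Tendsto (fun n : ℕ => W * ((n : ℝ) * r ^ n + r ^ n)) Filter.atTop (nhds 0) := by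
    simpa using ((tendsto_self_mul_const_pow_of_lt_one hr0.le hr1).add
      (tendsto_pow_atTop_nhds_zero_of_lt_one hr0.le hr1)).const_mul W
  refine h1.congr fun n => ?_
  rw [Real.norm_of_nonneg (hpos _).le, Real.norm_of_nonneg (hpos _).le, eq_div_iff (hpos n).ne',
    Finset.prod_range_succ, Nat.factorial_succ]
  push_cast
  ring

theorem summable_det_integral {C : ℝ} (hB0 : 0 < B) (hB : B < Real.pi) (hC : 0 < C)
    {g : (n : ℕ) → Fin n → ℝ → ℂ} (hg : ∀ n j, ContinuousOn (g n j) (Set.Icc (-B) B))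
    (hgC : ∀ n j, ∀ θ ∈ Set.Icc (-B) B, ‖g n j θ‖ ≤ C) :
    Summable fun n : ℕ => (Matrix.of fun i j : Fin n =>
      ∫ θ in (-B)..B, unitPoint (-θ) ^ (i : ℕ) * g n j θ).det := by
  obtain ⟨p, K, r, hK, hr0, hr1, hdeg, hmonic, hp⟩ := exists_monic_norm_eval_unitPoint_le hB0 hB
  exact Summable.of_norm_bounded
    (summable_factorial_mul_pow_mul_prod (by positivity : 0 < K * C * (2 * B)) hr0 hr1)
    fun n => norm_det_integral_le hB0 hr0 hdeg hmonic hp (hg n) (hgC n)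

theorem arcMoment_sub_natCast (b c B : ℝ) (e : ℕ) (k : ℤ) (i : ℕ) :
    arcMoment b c B e (k - i) = ∫ θ in (-B)..B, unitPoint (-θ) ^ i *
      ((2 * (Real.pi : ℂ) * Complex.I)⁻¹ * (unitPoint θ * Complex.I * (unitPoint θ ^ k *
        ((b : ℂ) / (c + b * unitPoint θ)) ^ e))) := by
  rw [arcMoment, ← intervalIntegral.integral_const_mul]
  congr 1
  ext θ
  rw [zpow_sub₀ (unitPoint_ne_zero θ), unitPoint_neg, zpow_natCast, inv_pow]
  ring

theorem summable_det_borderedToeplitz {b c : ℝ} (hb : 0 < b) (hc : 0 < c) (hB0 : 0 < B)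
    (hB : B < Real.pi) :
    Summable fun n : ℕ => (borderedToeplitz (arcMoment b c B 1) (arcMoment b c B 2) n).det := by
  have hcont : ContinuousOn (fun θ : ℝ => (b : ℂ) / (c + b * unitPoint θ)) (Set.Icc (-B) B) := by
    refine continuousOn_const.div (continuousOn_const.add
      (continuousOn_const.mul continuous_unitPoint.continuousOn)) fun θ hθ => ?_
    exact Complex.slitPlane_ne_zero (add_mul_unitPoint_mem_slitPlane hc hb hB hθ)
  obtain ⟨C, hC⟩ := isCompact_Icc.exists_bound_of_continuousOn hcont
  set c' : ℂ := (2 * (Real.pi : ℂ) * Complex.I)⁻¹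
  have hsum := summable_det_integral (C := ‖c'‖ * (max 1 C) ^ 2) hB0 hB
    (mul_pos (norm_pos_iff.2 (inv_ne_zero Complex.two_pi_I_ne_zero)) (by positivity))
    (g := fun n j θ => c' * (unitPoint θ * Complex.I * (unitPoint θ ^ ((j : ℕ) : ℤ) *
      ((b : ℂ) / (c + b * unitPoint θ)) ^ (if (j : ℕ) + 1 < n then 1 else 2)))) ?_ ?_
  · refine ((summable_nat_add_iff 1).2 hsum).congr fun n => ?_
    congr 1
    ext i j
    rw [Matrix.of_apply, ← arcMoment_sub_natCast, borderedToeplitz, Matrix.of_apply]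
    simp only [Nat.add_lt_add_iff_right]
    split_ifs with h
    · rfl
    · rw [le_antisymm (Nat.lt_succ_iff.1 j.2) (not_lt.1 h)]
  · intro n j
    exact continuousOn_const.mul (continuousOn_arcMoment_integrand hb hc hB _ _)
  · intro n j θ hθ
    rw [norm_mul]
    refine mul_le_mul_of_nonneg_left ?_ (norm_nonneg _)
    rw [norm_mul, norm_mul, norm_mul, norm_zpow, norm_pow, norm_unitPoint, Complex.norm_I,
      one_zpow, one_mul, one_mul, one_mul]
    refine (pow_le_pow_left₀ (norm_nonneg _) ((hC θ hθ).trans (le_max_right 1 C)) _).trans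
      (pow_le_pow_right₀ (le_max_left 1 C) ?_)
    split_ifs <;> norm_num

end Decay

/-- The series `Σ_m D_m` (the speed of growth of the interface, defined through the
prescribed dynamics under the stationary measure) converges to the off-diagonal entry
`−(bc/a)·K⁻¹_{abc}(0,0;1,0)` of the inverse Kasteleyn matrix. -/
theorem speed_series_eq_kernel (a b c : ℝ)
    (ha : 0 < a) (hb : 0 < b) (hc : 0 < c)
    (habc : a < b + c) (hbca : b < c + a) (hcab : c < a + b) :
    HasSum (fun m : ℕ => D a b c m)
      (-(((b * c / a : ℝ)) : ℂ) * Kinv a b c 0 0 1 0) ∧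
    -(((b * c / a : ℝ)) : ℂ) * Kinv a b c 0 0 1 0 =
      -(((b * c / a : ℝ)) : ℂ) * ((2 * (Real.pi : ℂ) * Complex.I) ^ 2)⁻¹ *
        (∮ z in C(0, 1), ∮ w in C(0, 1),
          ((a : ℂ) + (b : ℂ) * z + (c : ℂ) * w)⁻¹) := by
  refine ⟨?_, by simp [Kinv, mul_assoc]⟩
  have hb' : (b : ℂ) ≠ 0 := Complex.ofReal_ne_zero.2 hb.ne'
  obtain ⟨A, φ, hA0, hAπ, hφ0, hφπ, hφA, hA⟩ := exists_triangle_angles ha hb hc habc hbca hcab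
  obtain ⟨B, hBdef⟩ : ∃ B, B = Real.pi - A + φ := ⟨_, rfl⟩
  have hB0 : 0 < B := by linarith
  have hB : B < Real.pi := by linarith
  have hτ := mul_kernelCoeff_eq_arcMoment_one ha hb hc hA0 hAπ hφ0 hφπ hB0 hB hA hBdef
  have hσ := mul_kernelCoeff_eq_arcMoment_two ha hb hc hA0 hAπ hφ0 hφπ hB0 hB hA hBdef
  set E : ℕ → ℂ := fun n => (borderedToeplitz (arcMoment b c B 1) (arcMoment b c B 2) n).det with hE
  have hD : ∀ m, D a b c m = (c / b : ℂ) * (E m - E (m + 1)) :=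
    D_eq_det_borderedToeplitz ha hb hc hA0 hAπ hA hτ hσ hB0 hB
  have hsum : Summable E := summable_det_borderedToeplitz hb hc hB0 hB
  have hE0 : E 0 = -((b : ℂ) ^ 2 / a * kernelCoeff a b c 0 0) := by
    have h0 := hσ 0
    simp only [Nat.cast_zero, neg_zero] at h0
    rw [h0]
    simp [hE, borderedToeplitz]
  have hs := (hsum.hasSum.sub ((summable_nat_add_iff 1).2 hsum).hasSum).mul_left (c / b : ℂ)
  rw [hsum.tsum_eq_zero_add, add_sub_cancel_right, hE0] at hs
  simp only [hD]
  have hlim : -(((b * c / a : ℝ)) : ℂ) * Kinv a b c 0 0 1 0 =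
      c / b * -((b : ℂ) ^ 2 / a * kernelCoeff a b c 0 0) := by
    rw [Kinv_eq_kernelCoeff]
    norm_num
    field_simp
  rw [hlim]
  exact hs
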